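/- Let a : ℕ → ℝ be a sequence with a(n) → +∞ and a(n) ≤ n - log n for all large n, and let p(n) = (log n + a(n))/n. Then the probability that the Erdős–Rényi random graph G(n, p(n)) is connected tends to 1 as n tends to infinity. If instead a(n) → -∞ (with log n + a(n) ≥ 0 for all large n), then the probability that G(n, p(n)) is connected tends to 0 as n tends to infinity. -/

import Mathlib

open Classical in
/-- The probability that the Erdős–Rényi random graph `G(n,p)` lies in the event `A`:
each graph `G` on `Fin n` has probability `p^(#edges of G) * (1-p)^((n choose 2) - #edges of G)`. -/
noncomputable def erProb (n : ℕ) (p : ℝ) (A : Set (SimpleGraph (Fin n))) : ℝ :=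
  ∑ G : SimpleGraph (Fin n),
    if G ∈ A then p ^ G.edgeSet.ncard * (1 - p) ^ (n.choose 2 - G.edgeSet.ncard) else 0

section Probability

open Finset

/-- The `G(n,p)` probability that every pair in a given set of pairs is a non-edge. -/
theorem erProb_disjoint_edgeSet (n : ℕ) (p : ℝ) (F : Finset (Sym2 (Fin n)))
    (hF : ∀ e ∈ F, ¬ e.IsDiag) :
    erProb n p {G | Disjoint G.edgeSet (F : Set (Sym2 (Fin n)))} = (1 - p) ^ #F := by
  classical
  set E : Finset (Sym2 (Fin n)) := (⊤ : SimpleGraph (Fin n)).edgeFinset with hE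
  have hmem : ∀ e, e ∈ E ↔ ¬ e.IsDiag := by
    intro e
    simp [hE]
  have hFE : F ⊆ E := fun e he => (hmem e).2 (hF e he)
  have hcard : #E = n.choose 2 := by
    rw [hE, SimpleGraph.card_edgeFinset_top_eq_card_choose_two, Fintype.card_fin]
  unfold erProb
  rw [← Finset.sum_filter]
  have key : ∑ A ∈ (E \ F).powerset, p ^ #A * (1 - p) ^ (n.choose 2 - #A) =
      (1 - p) ^ #F := by
    have h1 : ∀ A ∈ (E \ F).powerset, p ^ #A * (1 - p) ^ (n.choose 2 - #A) =
        (1 - p) ^ #F * (p ^ #A * (1 - p) ^ (#(E \ F) - #A)) := by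
      intro A hA
      have hA' := card_le_card (mem_powerset.1 hA)
      have h2 : n.choose 2 - #A = #F + (#(E \ F) - #A) := by
        have := card_sdiff_add_card_eq_card hFE
        omega
      rw [h2, pow_add]
      ring
    rw [sum_congr rfl h1, ← mul_sum, sum_pow_mul_eq_add_pow]
    simp
  rw [← key]
  refine sum_bij' (fun G _ => G.edgeFinset)
    (fun A _ => SimpleGraph.fromEdgeSet (A : Set (Sym2 (Fin n)))) ?_ ?_ ?_ ?_ ?_
  · intro G hG
    simp only [mem_filter, mem_univ, true_and, Set.mem_ofPred_eq] at hG
    rw [mem_powerset]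
    intro e he
    rw [SimpleGraph.mem_edgeFinset] at he
    rw [mem_sdiff, hmem]
    exact ⟨G.not_isDiag_of_mem_edgeSet he, fun h => Set.disjoint_left.1 hG he h⟩
  · intro A hA
    simp only [mem_filter, mem_univ, true_and, Set.mem_ofPred_eq, SimpleGraph.edgeSet_fromEdgeSet]
    rw [Set.disjoint_left]
    intro e he heF
    exact (mem_sdiff.1 (mem_powerset.1 hA he.1)).2 heF
  · intro G _
    simp
  · intro A hA
    ext e
    simp only [SimpleGraph.mem_edgeFinset, SimpleGraph.edgeSet_fromEdgeSet, Set.mem_sdiff, mem_coe]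
    exact ⟨fun h => h.1, fun h =>
      ⟨h, (hmem e).1 (mem_sdiff.1 (mem_powerset.1 hA h)).1⟩⟩
  · intro G _
    rw [← SimpleGraph.coe_edgeFinset, Set.ncard_coe_finset]

theorem erProb_univ (n : ℕ) (p : ℝ) : erProb n p Set.univ = 1 := by
  have h := erProb_disjoint_edgeSet n p ∅ (by simp)
  simpa using h

theorem erProb_mono {n : ℕ} {p : ℝ} (h0 : 0 ≤ p) (h1 : p ≤ 1)
    {A B : Set (SimpleGraph (Fin n))} (h : A ⊆ B) : erProb n p A ≤ erProb n p B := by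
  classical
  have hq : 0 ≤ 1 - p := by linarith
  unfold erProb
  refine sum_le_sum fun G _ => ?_
  by_cases hA : G ∈ A
  · simp [hA, h hA]
  · rw [if_neg hA]
    split_ifs <;> positivity

theorem erProb_nonneg {n : ℕ} {p : ℝ} (h0 : 0 ≤ p) (h1 : p ≤ 1)
    (A : Set (SimpleGraph (Fin n))) : 0 ≤ erProb n p A := by
  have h := erProb_mono h0 h1 (Set.empty_subset A)
  simpa [erProb] using h

theorem erProb_add_compl (n : ℕ) (p : ℝ) (A : Set (SimpleGraph (Fin n))) :
    erProb n p A + erProb n p Aᶜ = 1 := by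
  classical
  rw [← erProb_univ n p]
  unfold erProb
  rw [← sum_add_distrib]
  refine sum_congr rfl fun G _ => ?_
  by_cases hA : G ∈ A <;> simp [hA]

theorem erProb_biUnion_le {n : ℕ} {p : ℝ} (h0 : 0 ≤ p) (h1 : p ≤ 1) {ι : Type*}
    (s : Finset ι) (A : ι → Set (SimpleGraph (Fin n))) :
    erProb n p (⋃ i ∈ s, A i) ≤ ∑ i ∈ s, erProb n p (A i) := by
  classical
  have hq : 0 ≤ 1 - p := by linarith
  unfold erProb
  rw [sum_comm]
  refine sum_le_sum fun G _ => ?_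
  have hnn : ∀ i ∈ s, (0 : ℝ) ≤ if G ∈ A i then
      p ^ G.edgeSet.ncard * (1 - p) ^ (n.choose 2 - G.edgeSet.ncard) else 0 := by
    intro i _
    split_ifs <;> positivity
  split_ifs with h
  · obtain ⟨i, hi, hG⟩ := Set.mem_iUnion₂.1 h
    have := single_le_sum hnn hi
    rwa [if_pos hG] at this
  · exact sum_nonneg hnn

/-- The pairs with one endpoint in `S` and the other outside `S`. -/
def cutPairs {n : ℕ} (S : Finset (Fin n)) : Finset (Sym2 (Fin n)) :=
  (S ×ˢ Sᶜ).image fun x => s(x.1, x.2)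

theorem card_cutPairs {n : ℕ} (S : Finset (Fin n)) : #(cutPairs S) = #S * (n - #S) := by
  rw [cutPairs, card_image_of_injOn, card_product, card_compl, Fintype.card_fin]
  rintro ⟨a, b⟩ hab ⟨c, d⟩ hcd h
  simp only [coe_product, Set.mem_prod, mem_coe, mem_compl] at hab hcd
  rcases Sym2.eq_iff.1 h with ⟨h1, h2⟩ | ⟨h1, h2⟩
  · exact Prod.ext h1 h2
  · have h1' : a = d := h1
    exact absurd (h1' ▸ hab.1) hcd.2

theorem not_isDiag_of_mem_cutPairs {n : ℕ} {S : Finset (Fin n)} {e : Sym2 (Fin n)}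
    (he : e ∈ cutPairs S) : ¬ e.IsDiag := by
  obtain ⟨⟨a, b⟩, hab, rfl⟩ := mem_image.1 he
  simp only [mem_product, mem_compl] at hab
  rw [Sym2.mk_isDiag_iff]
  intro (h : a = b)
  exact hab.2 (h ▸ hab.1)

theorem erProb_disjoint_cutPairs {n : ℕ} (p : ℝ) (S : Finset (Fin n)) :
    erProb n p {G | Disjoint G.edgeSet (cutPairs S : Set (Sym2 (Fin n)))} =
      (1 - p) ^ (#S * (n - #S)) := by
  rw [erProb_disjoint_edgeSet n p _ fun e he => not_isDiag_of_mem_cutPairs he, card_cutPairs]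

theorem disjoint_edgeSet_cutPairs_iff {n : ℕ} (G : SimpleGraph (Fin n)) (S : Finset (Fin n)) :
    Disjoint G.edgeSet (cutPairs S : Set (Sym2 (Fin n))) ↔ ∀ a ∈ S, ∀ b ∉ S, ¬ G.Adj a b := by
  rw [Set.disjoint_right]
  constructor
  · intro h a ha b hb hab
    exact h (mem_coe.2 (mem_image.2 ⟨(a, b), by simp [ha, hb], rfl⟩)) hab
  · rintro h e he heG
    obtain ⟨⟨a, b⟩, hab, rfl⟩ := mem_image.1 (mem_coe.1 he)
    simp only [mem_product, mem_compl] at hab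
    exact h a hab.1 b hab.2 heG

/-- A disconnected graph has an isolated nonempty set of at most half of its vertices. -/
theorem exists_disjoint_cutPairs_of_not_connected {n : ℕ} (hn : 0 < n) {G : SimpleGraph (Fin n)}
    (hG : ¬ G.Connected) :
    ∃ S : Finset (Fin n), 0 < #S ∧ 2 * #S ≤ n ∧
      Disjoint G.edgeSet (cutPairs S : Set (Sym2 (Fin n))) := by
  classical
  have : Nonempty (Fin n) := ⟨⟨0, hn⟩⟩
  have hpre : ¬ G.Preconnected := fun h => hG ⟨h⟩
  simp only [SimpleGraph.Preconnected, not_forall] at hpre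
  obtain ⟨u, v, huv⟩ := hpre
  set T : Finset (Fin n) := univ.filter fun w => G.Reachable u w with hT
  have hu : u ∈ T := by simp [hT]
  have hv : v ∈ Tᶜ := by simpa [hT] using huv
  have hcl : ∀ a ∈ T, ∀ b ∉ T, ¬ G.Adj a b := by
    intro a ha b hb hab
    simp only [hT, mem_filter, mem_univ, true_and] at ha hb
    exact hb (ha.trans hab.reachable)
  have hsum : #T + #Tᶜ = n := by simp
  rcases le_total (#T) (#Tᶜ) with h | h
  · exact ⟨T, card_pos.2 ⟨u, hu⟩, by omega, (disjoint_edgeSet_cutPairs_iff G T).2 hcl⟩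
  · refine ⟨Tᶜ, card_pos.2 ⟨v, hv⟩, by omega, (disjoint_edgeSet_cutPairs_iff G _).2 ?_⟩
    intro a ha b hb hab
    exact hcl b (by simpa using hb) a (by simpa using ha) hab.symm

/-- Union bound over the possible isolated sets of vertices. -/
theorem erProb_not_connected_le {n : ℕ} (hn : 0 < n) {p : ℝ} (h0 : 0 ≤ p) (h1 : p ≤ 1) :
    erProb n p {G | G.Connected}ᶜ ≤
      ∑ k ∈ Icc 1 (n / 2), (n.choose k : ℝ) * (1 - p) ^ (k * (n - k)) := by
  classical
  have hsub : ({G | G.Connected}ᶜ : Set (SimpleGraph (Fin n))) ⊆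
      ⋃ S ∈ univ.filter (fun S : Finset (Fin n) => #S ∈ Icc 1 (n / 2)),
        {G | Disjoint G.edgeSet (cutPairs S : Set (Sym2 (Fin n)))} := by
    intro G hG
    obtain ⟨S, h1, h2, h3⟩ := exists_disjoint_cutPairs_of_not_connected hn hG
    refine Set.mem_iUnion₂.2 ⟨S, ?_, h3⟩
    simp only [mem_filter, mem_univ, true_and, mem_Icc]
    omega
  refine (erProb_mono h0 h1 hsub).trans ((erProb_biUnion_le h0 h1 _ _).trans_eq ?_)
  simp only [erProb_disjoint_cutPairs]
  rw [← sum_fiberwise_of_maps_to (g := card) (t := Icc 1 (n / 2)) (by simp)]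
  refine sum_congr rfl fun k hk => ?_
  have hfib : (univ.filter (fun S : Finset (Fin n) => #S ∈ Icc 1 (n / 2))).filter
      (fun S => #S = k) = powersetCard k univ := by
    ext S
    simp only [mem_filter, mem_univ, true_and, mem_powersetCard, subset_univ]
    exact ⟨fun h => h.2, fun h => ⟨h ▸ hk, h⟩⟩
  rw [hfib, sum_congr rfl (g := fun _ => (1 - p) ^ (k * (n - k)))
    (fun S hS => by rw [(mem_powersetCard.1 hS).2])]
  simp

/-- Second moment bound on the probability of having no isolated vertex. -/
theorem erProb_connected_le {n : ℕ} (hn : 2 ≤ n) {p : ℝ} (h0 : 0 ≤ p) (h1 : p < 1) :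
    erProb n p {G | G.Connected} ≤ 1 / (n * (1 - p) ^ (n - 1)) + p / (1 - p) := by
  classical
  have hq : 0 < 1 - p := by linarith
  set q := 1 - p with hqdef
  have hnpos : (0 : ℝ) < n := by exact_mod_cast (by omega : 0 < n)
  set w : SimpleGraph (Fin n) → ℝ := fun G =>
    p ^ G.edgeSet.ncard * q ^ (n.choose 2 - G.edgeSet.ncard) with hw
  have hw0 : ∀ G, 0 ≤ w G := fun G => by simp only [hw]; positivity
  have hprob : ∀ A : Set (SimpleGraph (Fin n)),
      erProb n p A = ∑ G, w G * (if G ∈ A then 1 else 0) := by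
    intro A
    unfold erProb
    refine sum_congr rfl fun G _ => ?_
    split_ifs <;> simp [hw, hqdef]
  set I : Fin n → Set (SimpleGraph (Fin n)) := fun v =>
    {G | Disjoint G.edgeSet (cutPairs {v} : Set (Sym2 (Fin n)))} with hI
  set X : SimpleGraph (Fin n) → ℝ := fun G => ∑ v, if G ∈ I v then 1 else 0 with hX
  set μ : ℝ := n * q ^ (n - 1) with hμ
  have hμpos : 0 < μ := by positivity
  have hPI : ∀ v, erProb n p (I v) = q ^ (n - 1) := by
    intro v
    simp only [hI, erProb_disjoint_cutPairs, card_singleton, one_mul, hqdef]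
  have hone : ∑ G, w G = 1 := by
    have := erProb_univ n p
    rw [hprob] at this
    simpa using this
  have hEX : ∑ G, w G * X G = μ := by
    simp only [hX, mul_sum]
    rw [sum_comm]
    simp only [← hprob, hPI]
    simp [hμ]
  have hPII : ∀ u v, u ≠ v → erProb n p (I u ∩ I v) ≤ q ^ (2 * n - 3) := by
    intro u v huv
    have hset : I u ∩ I v = {G | Disjoint G.edgeSet
        ((cutPairs {u} ∪ cutPairs {v} : Finset (Sym2 (Fin n))) : Set (Sym2 (Fin n)))} := by
      ext G
      simp [hI, Set.disjoint_union_right]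
    rw [hset, erProb_disjoint_edgeSet]
    · refine pow_le_pow_of_le_one hq.le (by linarith) ?_
      have hinter : cutPairs {u} ∩ cutPairs {v} ⊆ ({s(u, v)} : Finset (Sym2 (Fin n))) := by
        intro e he
        obtain ⟨he1, he2⟩ := mem_inter.1 he
        obtain ⟨⟨a, b⟩, hab, rfl⟩ := mem_image.1 he1
        obtain ⟨⟨c, d⟩, hcd, h⟩ := mem_image.1 he2
        simp only [mem_product, mem_singleton, mem_compl] at hab hcd ⊢
        obtain ⟨rfl, -⟩ := hab
        obtain ⟨rfl, -⟩ := hcd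
        rcases Sym2.eq_iff.1 h with ⟨h1, h2⟩ | ⟨h1, h2⟩
        · exact absurd h1.symm huv
        · exact congrArg _ (h1.symm)
      have h1 := card_le_card hinter
      have h2 := card_union_add_card_inter (cutPairs {u}) (cutPairs {v})
      rw [card_cutPairs, card_cutPairs] at h2
      simp only [card_singleton] at h1 h2
      omega
    · intro e he
      rcases mem_union.1 he with he | he <;> exact not_isDiag_of_mem_cutPairs he
  have hEXX : ∑ G, w G * X G ^ 2 ≤ μ + n ^ 2 * q ^ (2 * n - 3) := by
    have hexp : ∑ G, w G * X G ^ 2 = ∑ u, ∑ v, erProb n p (I u ∩ I v) := by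
      simp only [hprob]
      rw [sum_congr rfl fun u _ => sum_comm, sum_comm]
      refine sum_congr rfl fun G _ => ?_
      simp only [← mul_sum, hX, sq]
      rw [sum_mul_sum]
      congr 1
      refine sum_congr rfl fun u _ => sum_congr rfl fun v _ => ?_
      by_cases hu : G ∈ I u <;> by_cases hv : G ∈ I v <;> simp [hu, hv]
    rw [hexp]
    have hle : ∀ u v, erProb n p (I u ∩ I v) ≤
        (if u = v then q ^ (n - 1) else 0) + q ^ (2 * n - 3) := by
      intro u v
      by_cases huv : u = v
      · subst huv
        rw [Set.inter_self, hPI, if_pos rfl]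
        linarith [pow_pos hq (2 * n - 3)]
      · rw [if_neg huv, zero_add]
        exact hPII u v huv
    refine (sum_le_sum fun u _ => sum_le_sum fun v _ => hle u v).trans_eq ?_
    simp only [sum_add_distrib, sum_ite_eq, mem_univ, if_true, sum_const, card_univ,
      Fintype.card_fin, nsmul_eq_mul, hμ]
    ring
  have hvar : ∑ G, w G * (X G - μ) ^ 2 ≤ μ + n ^ 2 * q ^ (2 * n - 3) - μ ^ 2 := by
    have : ∑ G, w G * (X G - μ) ^ 2 =
        ∑ G, w G * X G ^ 2 - 2 * μ * ∑ G, w G * X G + μ ^ 2 * ∑ G, w G := by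
      simp only [mul_sum]
      rw [← sum_sub_distrib, ← sum_add_distrib]
      exact sum_congr rfl fun G _ => by ring
    rw [this, hEX, hone]
    linarith
  have hcheb : μ ^ 2 * erProb n p {G | G.Connected} ≤ ∑ G, w G * (X G - μ) ^ 2 := by
    rw [hprob, mul_sum]
    refine sum_le_sum fun G _ => ?_
    by_cases hG : G.Connected
    · have hX0 : X G = 0 := by
        refine sum_eq_zero fun v _ => if_neg fun hv => ?_
        have hv' := (disjoint_edgeSet_cutPairs_iff G {v}).1 hv
        have : Nontrivial (Fin n) := Fin.nontrivial_iff_two_le.2 hn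
        obtain ⟨u, hu⟩ := hG.preconnected.exists_adj_of_nontrivial v
        exact hv' v (by simp) u (by simpa using hu.ne') hu
      rw [if_pos (show G ∈ {G : SimpleGraph (Fin n) | G.Connected} from hG), hX0]
      exact le_of_eq (by ring)
    · rw [if_neg (show G ∉ {G : SimpleGraph (Fin n) | G.Connected} from hG)]
      simpa using mul_nonneg (hw0 G) (sq_nonneg _)
  have hident : μ ^ 2 * (1 / μ + p / q) = μ + n ^ 2 * q ^ (2 * n - 3) - μ ^ 2 := by
    have e1 : q ^ (n - 1) * q ^ (n - 1) = q ^ (2 * n - 3) * q := by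
      rw [← pow_add, ← pow_succ]
      congr 1
      omega
    have e2 : μ ^ 2 = n ^ 2 * q ^ (2 * n - 3) * q := by
      rw [hμ, mul_pow, sq (q ^ (n - 1)), e1]
      ring
    have e3 : μ ^ 2 * (1 / μ) = μ := by field_simp
    have e4 : μ ^ 2 * (p / q) = n ^ 2 * q ^ (2 * n - 3) * p := by
      rw [e2]
      field_simp
    rw [mul_add, e3, e4, e2]
    have : p = 1 - q := by rw [hqdef]; ring
    rw [this]
    ring
  have hfin : μ ^ 2 * erProb n p {G | G.Connected} ≤ μ ^ 2 * (1 / μ + p / q) := by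
    rw [hident]
    exact hcheb.trans hvar
  exact le_of_mul_le_mul_left hfin (by positivity)

end Probability

section Asymptotics

open Filter Topology

theorem choose_mul_one_sub_pow_le {n k : ℕ} (hk : 1 ≤ k) (hkn : 2 * k ≤ n) {a : ℝ} (ha : 0 ≤ a)
    (hle : a ≤ n - Real.log n) :
    (n.choose k : ℝ) * (1 - (Real.log n + a) / n) ^ (k * (n - k)) ≤
      Real.exp (2 - a / 2) ^ k := by
  have hkpos : (0 : ℝ) < k := by exact_mod_cast hk
  have hnpos : (0 : ℝ) < n := by exact_mod_cast (by omega : 0 < n)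
  have hkn' : 2 * (k : ℝ) ≤ n := by exact_mod_cast hkn
  set p : ℝ := (Real.log n + a) / n with hp
  have hp1 : p ≤ 1 := by
    rw [hp, div_le_one hnpos]
    linarith
  have hpn : p * n = Real.log n + a := by rw [hp]; field_simp
  have hchoose : (n.choose k : ℝ) ≤ Real.exp (k * (Real.log n + 1 - Real.log k)) := by
    have h1 : (n.choose k : ℝ) ≤ (n : ℝ) ^ k / k.factorial := Nat.choose_le_pow_div k n
    have h2 : (k : ℝ) ^ k / k.factorial ≤ Real.exp k :=
      Real.pow_div_factorial_le_exp k hkpos.le k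
    have h3 : Real.exp (k * (Real.log n + 1 - Real.log k)) =
        (n : ℝ) ^ k * Real.exp k / (k : ℝ) ^ k := by
      rw [show (k : ℝ) * (Real.log n + 1 - Real.log k) =
        k * Real.log n + k - k * Real.log k by ring, Real.exp_sub, Real.exp_add,
        Real.exp_nat_mul, Real.exp_nat_mul, Real.exp_log hnpos, Real.exp_log hkpos]
    rw [h3]
    refine h1.trans ?_
    have hf : (0 : ℝ) < k.factorial := by exact_mod_cast k.factorial_pos
    rw [div_le_iff₀ hf] at h2
    rw [div_le_div_iff₀ hf (by positivity)]
    calc (n : ℝ) ^ k * (k : ℝ) ^ k ≤ (n : ℝ) ^ k * (Real.exp k * k.factorial) := by gcongr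
      _ = _ := by ring
  have hpow : (1 - p) ^ (k * (n - k)) ≤ Real.exp (-(p * (k * (n - k)))) := by
    have h1 : 1 - p ≤ Real.exp (-p) := Real.one_sub_le_exp_neg p
    refine (pow_le_pow_left₀ (by linarith) h1 _).trans_eq ?_
    rw [← Real.exp_nat_mul]
    congr 1
    rw [Nat.cast_mul, Nat.cast_sub (by omega)]
    ring
  have hlog : k * Real.log n / n ≤ Real.log k + 1 := by
    have h1 : Real.log n = Real.log k + Real.log (n / k) := by
      rw [Real.log_div hnpos.ne' hkpos.ne']
      ring
    have h2 : Real.log (n / k) ≤ n / k := Real.log_le_self (by positivity)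
    have h3 : 0 ≤ Real.log k := Real.log_nonneg (by exact_mod_cast hk)
    rw [div_le_iff₀ hnpos, h1]
    have h4 : k * Real.log (n / k) ≤ n := by
      calc k * Real.log (n / k) ≤ k * ((n : ℝ) / k) := by gcongr
        _ = n := by field_simp
    nlinarith
  have hka : k * a / n ≤ a / 2 := by
    rw [div_le_div_iff₀ hnpos two_pos]
    nlinarith
  have hkp : p * k ≤ Real.log k + 1 + a / 2 := by
    have : p * k = k * Real.log n / n + k * a / n := by rw [hp]; ring
    linarith
  calc (n.choose k : ℝ) * (1 - p) ^ (k * (n - k))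
      ≤ Real.exp (k * (Real.log n + 1 - Real.log k)) * Real.exp (-(p * (k * (n - k)))) :=
        mul_le_mul hchoose hpow (pow_nonneg (by linarith) _) (Real.exp_nonneg _)
    _ = Real.exp (k * (1 - Real.log k - a + p * k)) := by
        rw [← Real.exp_add]
        congr 1
        linear_combination (-(k : ℝ)) * hpn
    _ ≤ Real.exp (k * (2 - a / 2)) := by
        refine Real.exp_le_exp.2 (mul_le_mul_of_nonneg_left ?_ hkpos.le)
        linarith
    _ = Real.exp (2 - a / 2) ^ k := Real.exp_nat_mul _ _

theorem tendsto_erProb_connected_one {a : ℕ → ℝ} (ha : Tendsto a atTop atTop)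
    (hle : ∀ᶠ n : ℕ in atTop, a n ≤ n - Real.log n) :
    Tendsto (fun n : ℕ => erProb n ((Real.log n + a n) / n) {G | G.Connected}) atTop (𝓝 1) := by
  set r : ℕ → ℝ := fun n => Real.exp (2 - a n / 2) with hr
  have hr0 : Tendsto r atTop (𝓝 0) := by
    refine Real.tendsto_exp_atBot.comp ?_
    exact tendsto_atBot_add_const_left _ 2
      (tendsto_neg_atTop_atBot.comp (ha.atTop_div_const two_pos))
  have hlow : Tendsto (fun n => 1 - r n / (1 - r n)) atTop (𝓝 1) := by
    have := (hr0.div (tendsto_const_nhds.sub hr0) (by norm_num : (1 : ℝ) - 0 ≠ 0)).const_sub 1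
    simpa using this
  have hev : ∀ᶠ n : ℕ in atTop, 0 < n ∧ 0 ≤ a n ∧ a n ≤ n - Real.log n ∧ r n < 1 :=
    (eventually_gt_atTop 0).and ((ha.eventually_ge_atTop 0).and
      (hle.and (hr0.eventually_lt_const one_pos)))
  refine tendsto_of_tendsto_of_tendsto_of_le_of_le' hlow tendsto_const_nhds ?_ ?_
  all_goals
    filter_upwards [hev] with n ⟨hn, ha0, han, hrn⟩
    have hnpos : (0 : ℝ) < n := by exact_mod_cast hn
    have hlogn : 0 ≤ Real.log n := Real.log_natCast_nonneg n
    have h0 : 0 ≤ (Real.log n + a n) / n := by positivity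
    have h1 : (Real.log n + a n) / n ≤ 1 := by
      rw [div_le_one hnpos]
      linarith
    have hadd := erProb_add_compl n ((Real.log n + a n) / n) {G | G.Connected}
  · have hrpos : 0 ≤ r n := Real.exp_nonneg _
    have hsum : erProb n ((Real.log n + a n) / n) {G | G.Connected}ᶜ ≤ r n / (1 - r n) := by
      refine (erProb_not_connected_le hn h0 h1).trans ?_
      calc _ ≤ ∑ k ∈ Finset.Icc 1 (n / 2), r n ^ k := by
            refine Finset.sum_le_sum fun k hk => ?_
            rw [Finset.mem_Icc] at hk
            exact choose_mul_one_sub_pow_le hk.1 (by omega) ha0 han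
        _ = ∑ k ∈ Finset.Ico 1 (n / 2 + 1), r n ^ k := rfl
        _ = r n * ∑ k ∈ Finset.range (n / 2), r n ^ k := by
            rw [Finset.sum_Ico_eq_sum_range, Finset.mul_sum]
            simp [pow_add]
        _ ≤ r n * (1 - r n)⁻¹ := by
            refine mul_le_mul_of_nonneg_left ?_ hrpos
            rw [← tsum_geometric_of_lt_one hrpos hrn]
            exact (summable_geometric_of_lt_one hrpos hrn).sum_le_tsum _
              fun i _ => pow_nonneg hrpos i
        _ = r n / (1 - r n) := rfl
    linarith
  · linarith [erProb_nonneg h0 h1 {G : SimpleGraph (Fin n) | G.Connected}ᶜ]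

theorem exp_le_natCast_mul_one_sub_pow {n : ℕ} (hn : 0 < n) {p a : ℝ} (h0 : 0 ≤ p)
    (h1 : p ≤ 1 / 2) (hp : p * n = Real.log n + a) (hsq : p ^ 2 * n ≤ 1) :
    Real.exp (-a - 2) ≤ n * (1 - p) ^ (n - 1) := by
  have hnpos : (0 : ℝ) < n := by exact_mod_cast hn
  have hq : 0 < 1 - p := by linarith
  have hlog : -p - 2 * p ^ 2 ≤ Real.log (1 - p) := by
    refine le_trans ?_ (Real.one_sub_inv_le_log_of_pos hq)
    rw [inv_eq_one_div, le_sub_comm, div_le_iff₀ hq]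
    nlinarith [mul_nonneg (sq_nonneg p) (by linarith : (0 : ℝ) ≤ 1 - 2 * p)]
  calc Real.exp (-a - 2) ≤ Real.exp (Real.log n + n * Real.log (1 - p)) := by
        refine Real.exp_le_exp.2 ?_
        nlinarith
    _ = n * (1 - p) ^ n := by
        rw [Real.exp_add, Real.exp_nat_mul, Real.exp_log hnpos, Real.exp_log hq]
    _ ≤ n * (1 - p) ^ (n - 1) := by
        refine mul_le_mul_of_nonneg_left ?_ hnpos.le
        exact pow_le_pow_of_le_one hq.le (by linarith) (Nat.sub_le n 1)

theorem tendsto_erProb_connected_zero {a : ℕ → ℝ} (ha : Tendsto a atTop atBot)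
    (hge : ∀ᶠ n : ℕ in atTop, 0 ≤ Real.log n + a n) :
    Tendsto (fun n : ℕ => erProb n ((Real.log n + a n) / n) {G | G.Connected}) atTop (𝓝 0) := by
  set p : ℕ → ℝ := fun n => (Real.log n + a n) / n with hp
  have hlogdiv : ∀ k : ℕ, Tendsto (fun n : ℕ => Real.log n ^ k / (n : ℝ)) atTop (𝓝 0) := fun k =>
    (Real.isLittleO_pow_log_id_atTop (n := k)).tendsto_div_nhds_zero.comp
      tendsto_natCast_atTop_atTop
  have hpos : ∀ᶠ n : ℕ in atTop, 0 ≤ p n := by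
    filter_upwards [hge] with n hn
    exact div_nonneg hn n.cast_nonneg
  have hp0 : Tendsto p atTop (𝓝 0) := by
    refine tendsto_of_tendsto_of_tendsto_of_le_of_le' tendsto_const_nhds (hlogdiv 1) hpos ?_
    filter_upwards [ha.eventually_le_atBot 0] with n hn
    rw [hp, pow_one]
    exact div_le_div_of_nonneg_right (by linarith) n.cast_nonneg
  have hbound : Tendsto (fun n => Real.exp (a n + 2) + p n / (1 - p n)) atTop (𝓝 0) := by
    have h1 : Tendsto (fun n => Real.exp (a n + 2)) atTop (𝓝 0) :=
      Real.tendsto_exp_atBot.comp (tendsto_atBot_add_const_right _ 2 ha)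
    have h2 := hp0.div (tendsto_const_nhds.sub hp0) (by norm_num : (1 : ℝ) - 0 ≠ 0)
    simpa using h1.add h2
  refine tendsto_of_tendsto_of_tendsto_of_le_of_le' tendsto_const_nhds hbound ?_ ?_
  · filter_upwards [hpos, hp0.eventually_le_const one_pos] with n h0 h1
    exact erProb_nonneg h0 h1 _
  · filter_upwards [hpos, hp0.eventually_le_const (show (0 : ℝ) < 1 / 2 by norm_num), hge,
      ha.eventually_le_atBot 0, (hlogdiv 2).eventually_le_const one_pos,
      eventually_ge_atTop 2] with n h0 h1 hge' ha0 hlog2 hn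
    have hnpos : (0 : ℝ) < n := by exact_mod_cast (by omega : 0 < n)
    have hpn : p n * n = Real.log n + a n := by simp only [hp]; field_simp
    have hsq : p n ^ 2 * n ≤ 1 := by
      have h2 : p n ^ 2 * n = (Real.log n + a n) ^ 2 / n := by simp only [hp]; field_simp
      rw [h2]
      refine le_trans ?_ hlog2
      gcongr
      linarith
    have hμ := exp_le_natCast_mul_one_sub_pow (by omega : 0 < n) h0 h1 hpn hsq
    refine (erProb_connected_le hn h0 (by linarith)).trans (add_le_add_left ?_ _)
    calc 1 / (n * (1 - p n) ^ (n - 1)) ≤ 1 / Real.exp (-a n - 2) :=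
          one_div_le_one_div_of_le (Real.exp_pos _) hμ
      _ = Real.exp (a n + 2) := by
          rw [one_div, ← Real.exp_neg]
          congr 1
          ring

end Asymptotics

/-- For `p n = (log n + a n) / n`: if `a n → +∞` (with `a n ≤ n - log n` eventually) then
`G(n, p n)` is connected with probability tending to 1; if `a n → -∞` (with
`log n + a n ≥ 0` eventually) then the probability of connectedness tends to 0. -/
theorem er_connected_prob_zero_one :
    (∀ a : ℕ → ℝ, Filter.Tendsto a Filter.atTop Filter.atTop →
      (∀ᶠ n : ℕ in Filter.atTop, a n ≤ n - Real.log n) →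
      Filter.Tendsto
        (fun n : ℕ => erProb n ((Real.log n + a n) / n) {G | G.Connected})
        Filter.atTop (nhds 1)) ∧
    (∀ a : ℕ → ℝ, Filter.Tendsto a Filter.atTop Filter.atBot →
      (∀ᶠ n : ℕ in Filter.atTop, 0 ≤ Real.log n + a n) →
      Filter.Tendsto
        (fun n : ℕ => erProb n ((Real.log n + a n) / n) {G | G.Connected})
        Filter.atTop (nhds 0)) := by
  exact ⟨fun _ ha hle => tendsto_erProb_connected_one ha hle,
    fun _ ha hge => tendsto_erProb_connected_zero ha hge⟩
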